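/- Let p be an odd prime and q a prime number with q ≠ p. Let K be a number field containing a primitive p-th root of unity ζ, and let k be a subfield of K with K = k(ζ) and [K : k] = 2. Let 𝔮 be a nonzero prime ideal of the ring of integers O_k of k lying above q. If there is exactly one prime ideal of O_K lying above 𝔮 (i.e. 𝔮 does not split in K/k), then p does not divide the order of the unit group (O_k/𝔮)^× of the finite residue ring O_k/𝔮. -/

import Mathlib

open NumberField

/-- Let `p` be an odd prime and `q` a prime with `q ≠ p`. Let `K` be a number field
containing a primitive `p`-th root of unity `ζ`, and `k` a subfield with `K = k(ζ)` and
`[K : k] = 2`. If a nonzero prime ideal `𝔮` of `𝓞 k` lying above `q` has exactly one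
prime of `𝓞 K` above it, then `p` does not divide the order of `(𝓞 k ⧸ 𝔮)ˣ`. -/
theorem stmt0 (p q : ℕ) (hp : p.Prime) (hpodd : Odd p) (hq : q.Prime) (hqp : q ≠ p)
    (k K : Type*) [Field k] [Field K] [NumberField k] [NumberField K] [Algebra k K]
    (ζ : K) (hζ : IsPrimitiveRoot ζ p)
    (hadj : IntermediateField.adjoin k {ζ} = ⊤)
    (hdeg : Module.finrank k K = 2)
    (𝔮 : Ideal (𝓞 k)) (h𝔮prime : 𝔮.IsPrime) (h𝔮ne : 𝔮 ≠ ⊥)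
    (h𝔮q : (q : 𝓞 k) ∈ 𝔮)
    (hunique : ∃! P : Ideal (𝓞 K),
      P.IsPrime ∧ P.comap (algebraMap (𝓞 k) (𝓞 K)) = 𝔮) :
    ¬ p ∣ Nat.card (𝓞 k ⧸ 𝔮)ˣ := by
  obtain ⟨P, ⟨hP, hPq⟩, huniq⟩ := hunique
  intro hdvd
  have : Fact p.Prime := ⟨hp⟩
  have hmax : 𝔮.IsMaximal := h𝔮prime.isMaximal h𝔮ne
  have : Finite (𝓞 k ⧸ 𝔮) := Ideal.finiteQuotientOfFreeOfNeBot 𝔮 h𝔮ne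
  have : Algebra.IsQuadraticExtension k K := { finrank_eq_two' := hdeg }
  have : IsGalois k K := {}
  obtain ⟨σ, hσ⟩ : ∃ σ : K ≃ₐ[k] K, σ ζ ≠ ζ := by
    by_contra! h
    obtain ⟨c, hc⟩ := (IsGalois.mem_range_algebraMap_iff_fixed ζ).2 h
    have hbot : IntermediateField.adjoin k {ζ} = ⊥ := by
      rw [IntermediateField.adjoin_simple_eq_bot_iff, IntermediateField.mem_bot]
      exact ⟨c, hc⟩
    have htb : (⊥ : IntermediateField k K) = ⊤ := hbot.symm.trans hadj
    have h1 := IntermediateField.finrank_top' (F := k) (E := K)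
    rw [← htb, IntermediateField.finrank_bot, hdeg] at h1
    omega
  let τ : 𝓞 K →+* 𝓞 K := RingOfIntegers.mapRingHom (σ : K →+* K)
  have hτ (x : 𝓞 K) : ((τ x : 𝓞 K) : K) = σ x := rfl
  have hτk (c : 𝓞 k) : τ (algebraMap (𝓞 k) (𝓞 K) c) = algebraMap (𝓞 k) (𝓞 K) c := by
    apply RingOfIntegers.ext
    rw [hτ]
    exact σ.commutes (c : k)
  have hτP : P.comap τ = P := huniq _ ⟨inferInstance, by
    rw [Ideal.comap_comap, ← hPq]
    congr 1
    exact RingHom.ext hτk⟩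
  let z : 𝓞 K := hζ.toInteger
  have hz : IsPrimitiveRoot z p := hζ.toInteger_isPrimitiveRoot
  obtain ⟨c, hc⟩ : ∃ c : 𝓞 k, z - algebraMap (𝓞 k) (𝓞 K) c ∈ P := by
    obtain ⟨u, hu⟩ := exists_prime_orderOf_dvd_card' p hdvd
    have hu' : IsPrimitiveRoot (u : 𝓞 k ⧸ 𝔮) p :=
      IsPrimitiveRoot.coe_units_iff.2 (hu ▸ IsPrimitiveRoot.orderOf u)
    let φ : 𝓞 k ⧸ 𝔮 →+* 𝓞 K ⧸ P := Ideal.quotientMap P (algebraMap (𝓞 k) (𝓞 K)) hPq.ge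
    have hφ : Function.Injective φ := Ideal.quotientMap_injective' hPq.le
    have hzp : (Ideal.Quotient.mk P z) ^ p = 1 := by rw [← map_pow, hz.pow_eq_one, map_one]
    have : NeZero p := ⟨hp.ne_zero⟩
    obtain ⟨i, -, hi⟩ := (hu'.map_of_injective hφ).eq_pow_of_pow_eq_one hzp
    obtain ⟨c, hc⟩ := Ideal.Quotient.mk_surjective ((u : 𝓞 k ⧸ 𝔮) ^ i)
    refine ⟨c, Ideal.Quotient.eq.1 ?_⟩
    rw [← hi, ← map_pow, ← hc]
    exact Ideal.quotientMap_mk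
  have hτz : τ z - z ∈ P := by
    have h1 : τ (z - algebraMap (𝓞 k) (𝓞 K) c) ∈ P := by rwa [← Ideal.mem_comap, hτP]
    rw [map_sub, hτk] at h1
    simpa using P.sub_mem h1 hc
  have hne : τ z ≠ z := fun h => hσ (congrArg (algebraMap (𝓞 K) K) h)
  have hzu : IsUnit z := hz.isUnit hp.ne_zero
  obtain ⟨w, hw⟩ := hzu.dvd (a := τ z)
  have hw1 : w ≠ 1 := by rintro rfl; exact hne (by rw [hw, mul_one])
  have hwp : w ^ p = 1 := by
    have h1 : τ z ^ p = 1 := by rw [← map_pow, hz.pow_eq_one, map_one]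
    rwa [hw, mul_pow, hz.pow_eq_one, one_mul] at h1
  have hwP : w - 1 ∈ P := by
    have h1 : z * (w - 1) ∈ P := by rwa [mul_sub, mul_one, ← hw]
    exact (Ideal.unit_mul_mem_iff_mem P hzu).1 h1
  have hpP : (p : 𝓞 K) ∈ P := by
    have h0 : ∑ j ∈ Finset.range p, w ^ j = 0 := by
      have h1 := geom_sum_mul w p
      rw [hwp, sub_self] at h1
      exact (mul_eq_zero.1 h1).resolve_right (sub_ne_zero.2 hw1)
    have h2 : Ideal.Quotient.mk P w = 1 := by
      rw [← map_one (Ideal.Quotient.mk P)]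
      exact Ideal.Quotient.eq.2 hwP
    have h3 := congrArg (Ideal.Quotient.mk P) h0
    rw [← Ideal.Quotient.eq_zero_iff_mem]
    simpa [h2] using h3
  have hqP : (q : 𝓞 K) ∈ P := by
    rw [← hPq, Ideal.mem_comap, map_natCast] at h𝔮q
    exact h𝔮q
  apply hP.ne_top
  rw [Ideal.eq_top_iff_one]
  obtain ⟨a, b, hab⟩ := Nat.isCoprime_iff_coprime.2 ((Nat.coprime_primes hq hp).2 hqp)
  have h1 := congrArg (Int.cast : ℤ → 𝓞 K) hab
  push_cast at h1
  rw [← h1]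
  exact P.add_mem (P.mul_mem_left _ hqP) (P.mul_mem_left _ hpP)
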